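/- (Correctness of the first distributed two-erasure repair scheme.) Assume t ≥ 2, let k = |B|^t − |B|^{t−1}, and let α*, ᾱ ∈ F be distinct. Then there exists c ∈ F such that for every polynomial f ∈ F[x] with deg f ≤ k − 1: if Tr_{F/B}(f(α)/(α − α*)) = 0 and Tr_{F/B}(c·f(α)/(α − α*)) = 0 for all α ∈ F \ {α*, ᾱ}, then f(α*) = 0. In particular, the value f(α*) is determined by the sub-symbols Tr_{F/B}(f(α)/(α − α*)) and Tr_{F/B}(c·f(α)/(α − α*)), α ∈ F \ {α*, ᾱ}, without any information about f(ᾱ). -/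

import Mathlib

open Polynomial

/-- The field trace `Tr_{F/B}(x) = ∑_{i=0}^{t-1} x^{q^i}` (with `q = |B|`). -/
noncomputable def fTr (q t : ℕ) {F : Type*} [Field F] (x : F) : F :=
  ∑ i ∈ Finset.range t, x ^ q ^ i

/-- A polynomial of degree less than `|F| - 1` has zero sum of values over `F`. -/
theorem sum_eval_eq_zero_of_natDegree_lt {F : Type*} [Field F] [Fintype F] (f : F[X])
    (hf : f.natDegree < Fintype.card F - 1) : ∑ x : F, f.eval x = 0 := by
  simp_rw [eval_eq_sum_range]
  rw [Finset.sum_comm]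
  refine Finset.sum_eq_zero fun i hi => ?_
  rw [← Finset.mul_sum, FiniteField.sum_pow_lt_card_sub_one, mul_zero]
  have := Finset.mem_range.1 hi
  omega

theorem fTr_eq_algebraMap_trace {B F : Type*} [Field B] [Field F] [Algebra B F] [Fintype B]
    [Fintype F] {t : ℕ} (hF : Fintype.card F = Fintype.card B ^ t) (x : F) :
    fTr (Fintype.card B) t x = algebraMap B F (Algebra.trace B F x) := by
  have ht : Module.finrank B F = t := by
    have h := Module.card_eq_pow_finrank (K := B) (V := F)
    rw [hF] at h
    exact (Nat.pow_right_injective Fintype.one_lt_card h).symm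
  rw [FiniteField.algebraMap_trace_eq_sum_pow, ht, Nat.card_eq_fintype_card, fTr]

/-- The dual-code relation given by the check polynomial `Tr(u(x - a)) / (x - a)`. -/
theorem sum_eval_mul_trace_quotient_eq_zero {F : Type*} [Field F] [Fintype F] {q t : ℕ}
    (hq : 1 < q) (ht : 1 ≤ t) (hF : Fintype.card F = q ^ t) (a u : F) (f : F[X])
    (hf : f.natDegree ≤ q ^ t - q ^ (t - 1) - 1) :
    ∑ x : F, f.eval x * ∑ i ∈ Finset.range t, u ^ q ^ i * (x - a) ^ (q ^ i - 1) = 0 := by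
  simp_rw [Finset.mul_sum]
  rw [Finset.sum_comm]
  refine Finset.sum_eq_zero fun i hi => ?_
  have key : ∑ x : F, (f * (X - C a) ^ (q ^ i - 1)).eval x = 0 := by
    refine sum_eval_eq_zero_of_natDegree_lt _ ?_
    have h₁ : (f * (X - C a) ^ (q ^ i - 1)).natDegree ≤ f.natDegree + (q ^ i - 1) := by
      refine natDegree_mul_le.trans ?_
      simp
    have h₂ : q ^ i ≤ q ^ (t - 1) :=
      Nat.pow_le_pow_right (by omega) (by have := Finset.mem_range.1 hi; omega)
    have h₃ : q ^ (t - 1) < q ^ t := Nat.pow_lt_pow_right hq (by omega)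
    have h₄ : 0 < q ^ i := by positivity
    omega
  calc ∑ x : F, f.eval x * (u ^ q ^ i * (x - a) ^ (q ^ i - 1))
      = u ^ q ^ i * ∑ x : F, (f * (X - C a) ^ (q ^ i - 1)).eval x := by
        rw [Finset.mul_sum]
        refine Finset.sum_congr rfl fun x _ => ?_
        simp only [eval_mul, eval_pow, eval_sub, eval_X, eval_C]
        ring
    _ = 0 := by rw [key, mul_zero]

theorem sum_mul_pow_pred_eq_div {F : Type*} [Field F] {q t : ℕ} (hq : 1 < q) (u y : F)
    (hy : y ≠ 0) :
    ∑ i ∈ Finset.range t, u ^ q ^ i * y ^ (q ^ i - 1) = fTr q t (u * y) / y := by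
  rw [fTr, Finset.sum_div]
  refine Finset.sum_congr rfl fun i _ => ?_
  have h : 0 < q ^ i := by positivity
  rw [mul_pow, eq_div_iff hy, mul_assoc, pow_sub_one_mul h.ne']

theorem sum_mul_zero_pow_pred {F : Type*} [Field F] {q t : ℕ} (hq : 1 < q) (ht : 1 ≤ t) (u : F) :
    ∑ i ∈ Finset.range t, u ^ q ^ i * (0 : F) ^ (q ^ i - 1) = u := by
  rw [Finset.sum_eq_single_of_mem 0 (Finset.mem_range.2 (by omega))]
  · simp
  · intro i _ hi
    have : 1 < q ^ i := Nat.one_lt_pow hi hq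
    rw [zero_pow (by omega), mul_zero]

/-- If the sub-symbols `Tr(f(x) / (x - a))` vanish off `{a, b}`, then `f(a)` is trace-orthogonal
to every `u` with `Tr(u(b - a)) = 0`. -/
theorem trace_mul_eval_eq_zero {B F : Type*} [Field B] [Field F] [Algebra B F] [Fintype B]
    [Fintype F] {t : ℕ} (ht : 1 ≤ t) (hF : Fintype.card F = Fintype.card B ^ t) (a b : F)
    (f : F[X]) (hf : f.natDegree ≤ Fintype.card B ^ t - Fintype.card B ^ (t - 1) - 1)
    (h : ∀ x : F, x ≠ a → x ≠ b → Algebra.trace B F (f.eval x / (x - a)) = 0) (u : F)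
    (hu : Algebra.trace B F (u * (b - a)) = 0) : Algebra.trace B F (u * f.eval a) = 0 := by
  have hq : 1 < Fintype.card B := Fintype.one_lt_card
  have key := congrArg (Algebra.trace B F)
    (sum_eval_mul_trace_quotient_eq_zero hq ht hF a u f hf)
  rw [map_sum, map_zero] at key
  rw [← key, Finset.sum_eq_single a]
  · rw [sub_self, sum_mul_zero_pow_pred hq ht, mul_comm]
  · intro x _ hx
    rw [sum_mul_pow_pred_eq_div hq u _ (sub_ne_zero.2 hx), fTr_eq_algebraMap_trace hF]
    by_cases hxb : x = b
    · simp [hxb, hu]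
    · rw [mul_div_left_comm, ← Algebra.smul_def, map_smul, h x hx hxb, smul_zero]
  · simp

/-- The trace-orthogonal of the hyperplane `{u | Tr(u y) = 0}` is the line `B y`. -/
theorem exists_smul_eq_of_trace_orthogonal {B F : Type*} [Field B] [Field F] [Algebra B F]
    [FiniteDimensional B F] [Algebra.IsSeparable B F] {x y : F} (hy : y ≠ 0)
    (h : ∀ u : F, Algebra.trace B F (u * y) = 0 → Algebra.trace B F (u * x) = 0) :
    ∃ b : B, x = b • y := by
  obtain ⟨v, hv⟩ := Algebra.trace_surjective B F 1
  refine ⟨Algebra.trace B F (v / y * x), ?_⟩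
  rw [← sub_eq_zero]
  refine (traceForm_nondegenerate B F).1 _ fun u => ?_
  have hu := h (u - Algebra.trace B F (u * y) • (v / y)) (by
    rw [sub_mul, smul_mul_assoc, div_mul_cancel₀ _ hy, map_sub, map_smul, hv]
    simp)
  rw [sub_mul, smul_mul_assoc, map_sub, map_smul, smul_eq_mul] at hu
  rw [Algebra.traceForm_apply, mul_comm, mul_sub, mul_smul_comm, map_sub, map_smul, smul_eq_mul]
  linear_combination hu

/-- The repair scheme recovers a vanishing symbol for every multiplier `c` outside `B`. -/
theorem eval_eq_zero_of_trace_eq_zero {B F : Type*} [Field B] [Field F] [Algebra B F] [Fintype B]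
    [Fintype F] {t : ℕ} (ht : 1 ≤ t) (hF : Fintype.card F = Fintype.card B ^ t) {a b : F}
    (hab : a ≠ b) {c : F} (hc : c ∉ Set.range (algebraMap B F)) (f : F[X])
    (hf : f.natDegree ≤ Fintype.card B ^ t - Fintype.card B ^ (t - 1) - 1)
    (h₁ : ∀ x : F, x ≠ a → x ≠ b → Algebra.trace B F (f.eval x / (x - a)) = 0)
    (h₂ : ∀ x : F, x ≠ a → x ≠ b → Algebra.trace B F (c * f.eval x / (x - a)) = 0) :
    f.eval a = 0 := by
  have hy : b - a ≠ 0 := sub_ne_zero.2 hab.symm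
  obtain ⟨r, hr⟩ := exists_smul_eq_of_trace_orthogonal (B := B) hy
    (trace_mul_eval_eq_zero ht hF a b f hf h₁)
  obtain ⟨s, hs⟩ := exists_smul_eq_of_trace_orthogonal (B := B) hy
    (trace_mul_eval_eq_zero ht hF a b (C c * f) ((natDegree_C_mul_le c f).trans hf)
      (by simpa using h₂))
  rw [eval_mul, eval_C, hr, Algebra.smul_def, Algebra.smul_def, ← mul_assoc] at hs
  have hcr := mul_right_cancel₀ hy hs
  rcases eq_or_ne r 0 with rfl | hr₀
  · rw [hr, zero_smul]
  · refine absurd ⟨s / r, ?_⟩ hc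
    rw [map_div₀, div_eq_iff (by simpa using hr₀), hcr]

/-- Correctness of the first distributed two-erasure repair scheme. Assume `t ≥ 2`, let
`k = |B|^t - |B|^{t-1}` and let `α* ≠ ᾱ` in `F`. Then there exists `c ∈ F` such that for
every `f` with `deg f ≤ k - 1`: if `Tr(f(α)/(α-α*)) = 0` and `Tr(c·f(α)/(α-α*)) = 0` for
all `α ∈ F \ {α*, ᾱ}`, then `f(α*) = 0`. In particular `f(α*)` is determined by those
sub-symbols, without any information about `f(ᾱ)`. -/
theorem stmt10 (p m t : ℕ) (hp : p.Prime) (hm : 0 < m) (ht : 2 ≤ t)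
    (B F : Type*) [Field B] [Field F] [Algebra B F] [Fintype B] [Fintype F]
    (hB : Fintype.card B = p ^ m) (hF : Fintype.card F = Fintype.card B ^ t)
    (k : ℕ) (hk : k = Fintype.card B ^ t - Fintype.card B ^ (t - 1))
    (αs αb : F) (hne : αs ≠ αb) :
    ∃ c : F,
      (∀ f : Polynomial F, f.degree ≤ ((k - 1 : ℕ) : WithBot ℕ) →
        (∀ α : F, α ≠ αs → α ≠ αb →
          fTr (Fintype.card B) t (f.eval α / (α - αs)) = 0 ∧
          fTr (Fintype.card B) t (c * f.eval α / (α - αs)) = 0) →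
        f.eval αs = 0) ∧
      (∀ f g : Polynomial F, f.degree ≤ ((k - 1 : ℕ) : WithBot ℕ) →
        g.degree ≤ ((k - 1 : ℕ) : WithBot ℕ) →
        (∀ α : F, α ≠ αs → α ≠ αb →
          fTr (Fintype.card B) t (f.eval α / (α - αs))
            = fTr (Fintype.card B) t (g.eval α / (α - αs)) ∧
          fTr (Fintype.card B) t (c * f.eval α / (α - αs))
            = fTr (Fintype.card B) t (c * g.eval α / (α - αs))) →
        f.eval αs = g.eval αs) := by
  have hq : 1 < Fintype.card B := Fintype.one_lt_card
  obtain ⟨c, hc⟩ : ∃ c : F, c ∉ Set.range (algebraMap B F) := by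
    by_contra! hsurj
    have hle := Fintype.card_le_of_surjective _ hsurj
    rw [hF] at hle
    have hlt : Fintype.card B ^ 1 < Fintype.card B ^ t := Nat.pow_lt_pow_right hq (by omega)
    rw [pow_one] at hlt
    omega
  have main : ∀ f : F[X], f.degree ≤ ((k - 1 : ℕ) : WithBot ℕ) →
      (∀ α : F, α ≠ αs → α ≠ αb →
        fTr (Fintype.card B) t (f.eval α / (α - αs)) = 0 ∧
        fTr (Fintype.card B) t (c * f.eval α / (α - αs)) = 0) →
      f.eval αs = 0 := by
    intro f hf h
    simp only [fTr_eq_algebraMap_trace hF, map_eq_zero] at h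
    exact eval_eq_zero_of_trace_eq_zero (by omega) hF hne hc f
      (hk ▸ natDegree_le_iff_degree_le.2 hf) (fun x hx hxb => (h x hx hxb).1)
      (fun x hx hxb => (h x hx hxb).2)
  refine ⟨c, main, fun f g hf hg h => ?_⟩
  rw [← sub_eq_zero, ← eval_sub]
  refine main (f - g) ((degree_sub_le f g).trans (max_le hf hg)) fun α hα hαb => ?_
  obtain ⟨h₁, h₂⟩ := h α hα hαb
  simp only [fTr_eq_algebraMap_trace hF] at h₁ h₂ ⊢
  simp only [eval_sub, mul_sub, sub_div, map_sub, h₁, h₂, sub_self, and_self]
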